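/- Let V be a Banach space, ρ: G → GL(V) a weakly almost periodic representation of a group G, and K ⊆ V a norm-compact subset. Then for every ε > 0 there exists a finite convex combination δ = Σᵢ λᵢ hᵢ with λᵢ ∈ [0,1], Σᵢ λᵢ = 1 and hᵢ ∈ G, such that dist(Σᵢ λᵢ ρ(hᵢ)v, V^G) < ε for every v ∈ K. -/

import Mathlib

open Topology in
theorem wap_exists_minimal {X : Type*} [TopologicalSpace X] (P : Set X → Prop)
    (hP : ∀ c : Set (Set X), (∀ s ∈ c, P s) → P (⋂₀ c))
    (K : Set X) (hK : IsCompact K) (hKc : IsClosed K) (hKn : K.Nonempty) (hPK : P K) :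
    ∃ m ⊆ K, m.Nonempty ∧ IsClosed m ∧ P m ∧
      ∀ m' ⊆ m, m'.Nonempty → IsClosed m' → P m' → m' = m := by
  obtain ⟨m, hmK, hm⟩ := zorn_superset_nonempty
    {s : Set X | s ⊆ K ∧ s.Nonempty ∧ IsClosed s ∧ P s} (by
      intro c hc hchain hne
      refine ⟨⋂₀ c, ⟨?_, ?_, ?_, ?_⟩, fun s hs => Set.sInter_subset_of_mem hs⟩
      · obtain ⟨s, hs⟩ := hne
        exact (Set.sInter_subset_of_mem hs).trans (hc hs).1
      · have : Nonempty c := hne.to_subtype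
        refine IsCompact.nonempty_sInter_of_directed_nonempty_isCompact_isClosed ?_ ?_ ?_ ?_
        · exact IsChain.directedOn (r := fun a b : Set X => b ⊆ a) hchain.symm
        · exact fun s hs => (hc hs).2.1
        · exact fun s hs => hK.of_isClosed_subset (hc hs).2.2.1 (hc hs).1
        · exact fun s hs => (hc hs).2.2.1
      · exact isClosed_sInter fun s hs => (hc hs).2.2.1
      · exact hP c fun s hs => (hc hs).2.2.2) K ⟨subset_rfl, hKn, hKc, hPK⟩
  refine ⟨m, hmK, hm.prop.2.1, hm.prop.2.2.1, hm.prop.2.2.2, ?_⟩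
  intro m' hm' hne hcl hp
  exact Set.Subset.antisymm hm' (hm.le_of_le ⟨hm'.trans hmK, hne, hcl, hp⟩ hm')

section
variable {V : Type*} [NormedAddCommGroup V] [NormedSpace ℝ V]

theorem wap_inducing : Topology.IsInducing
    (fun (x : WeakSpace ℝ V) (f : StrongDual ℝ V) => f ((toWeakSpace ℝ V).symm x)) := ⟨rfl⟩

theorem wap_eval_cont (f : StrongDual ℝ V) :
    Continuous (fun x : WeakSpace ℝ V => f ((toWeakSpace ℝ V).symm x)) :=
  (continuous_apply f).comp wap_inducing.continuous

theorem wap_closedBall (c : V) (r : ℝ) :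
    IsClosed ((toWeakSpace ℝ V) '' Metric.closedBall c r) := by
  have := (convex_closedBall c r).toWeakSpace_closure ℝ
  rw [Metric.isClosed_closedBall.closure_eq] at this
  rw [this]
  exact isClosed_closure

theorem wap_mem_closure {A : Set V} {x : V} :
    toWeakSpace ℝ V x ∈ closure (toWeakSpace ℝ V '' A) ↔
      ∀ (k : ℕ) (F : Fin k → StrongDual ℝ V), ∃ a ∈ A, ∀ i, |F i a - F i x| < 1 := by
  constructor
  · intro h k F
    have ho : IsOpen {y : WeakSpace ℝ V |
        ∀ i, |F i ((toWeakSpace ℝ V).symm y) - F i x| < 1} := by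
      simp only [Set.setOf_forall]
      refine isOpen_iInter_of_finite fun i => ?_
      exact isOpen_lt (((wap_eval_cont (F i)).sub continuous_const).abs) continuous_const
    obtain ⟨y, hy, a, ha, rfl⟩ := mem_closure_iff.1 h _ ho (by simp)
    exact ⟨a, ha, by simpa using hy⟩
  · intro h
    rw [wap_inducing.closure_eq_preimage_closure_image]
    simp only [Set.mem_preimage]
    rw [mem_closure_iff_nhds_basis
      (by rw [nhds_pi]; exact Filter.hasBasis_pi (fun f => Metric.nhds_basis_ball))]
    rintro ⟨I, r⟩ ⟨hI, hr⟩
    obtain ⟨k, e, hinj, he⟩ : ∃ (k : ℕ) (e : Fin k → StrongDual ℝ V),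
        Function.Injective e ∧ Set.range e = I := by
      obtain ⟨k, e, he⟩ := hI.fin_param
      exact ⟨k, e, he⟩
    obtain ⟨a, ha, hlt⟩ := h k (fun i => (r (e i))⁻¹ • e i)
    refine ⟨_, ⟨_, ⟨a, ha, rfl⟩, rfl⟩, ?_⟩
    intro f hf
    rw [← he] at hf
    obtain ⟨i, rfl⟩ := hf
    have hpos : 0 < r (e i) := hr _ (he ▸ ⟨i, rfl⟩)
    have := hlt i
    simp only [ContinuousLinearMap.smul_apply, smul_eq_mul, ← mul_sub, abs_mul,
      abs_of_pos (inv_pos.2 hpos)] at this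
    rw [inv_mul_lt_iff₀ hpos, mul_one] at this
    simpa [Real.dist_eq] using this

theorem wap_kaplansky {A : Set V} {x : V}
    (h : toWeakSpace ℝ V x ∈ closure (toWeakSpace ℝ V '' A)) :
    ∃ D ⊆ A, D.Countable ∧ toWeakSpace ℝ V x ∈ closure (toWeakSpace ℝ V '' D) := by
  rw [wap_mem_closure] at h
  have key : ∀ p : ℕ × ℕ, ∃ D : Set V, D ⊆ A ∧ D.Finite ∧
      ∀ F : Fin p.1 → StrongDual ℝ V, (∀ i, ‖F i‖ ≤ p.2) → ∃ a ∈ D, ∀ i, |F i a - F i x| < 1 := by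
    rintro ⟨k, N⟩
    have hc : IsCompact (Set.pi Set.univ (fun _ : Fin k =>
        WeakDual.toStrongDual ⁻¹' Metric.closedBall (0 : StrongDual ℝ V) (N : ℝ))) :=
      isCompact_univ_pi fun _ => WeakDual.isCompact_closedBall _ _
    choose a haA ha using fun φ : Fin k → WeakDual ℝ V =>
      h k (fun i => WeakDual.toStrongDual (φ i))
    obtain ⟨t, -, ht⟩ := hc.elim_nhds_subcover
      (fun φ => {ψ : Fin k → WeakDual ℝ V | ∀ i, |ψ i (a φ) - ψ i x| < 1}) (by
        intro φ _
        refine IsOpen.mem_nhds ?_ (ha φ)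
        simp only [Set.setOf_forall]
        refine isOpen_iInter_of_finite fun i => ?_
        refine isOpen_lt (Continuous.abs (Continuous.sub ?_ ?_)) continuous_const
        · exact (WeakDual.eval_continuous (a φ)).comp (continuous_apply i)
        · exact (WeakDual.eval_continuous x).comp (continuous_apply i))
    refine ⟨a '' t, ?_, t.finite_toSet.image a, ?_⟩
    · rintro _ ⟨φ, _, rfl⟩
      exact haA φ
    · intro F hF
      have := ht (show (fun i => StrongDual.toWeakDual (F i)) ∈ _ from by
        intro i _
        simpa using hF i)
      simp only [Set.mem_iUnion] at this
      obtain ⟨φ, hφ, hlt⟩ := this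
      exact ⟨a φ, ⟨φ, hφ, rfl⟩, hlt⟩
  choose D hDA hDf hD using key
  refine ⟨⋃ p, D p, Set.iUnion_subset hDA,
    Set.countable_iUnion fun p => (hDf p).countable, ?_⟩
  rw [wap_mem_closure]
  intro k F
  obtain ⟨N, hN⟩ := exists_nat_ge (∑ i, ‖F i‖)
  obtain ⟨a, ha, hlt⟩ := hD (k, N) F (fun i =>
    (Finset.single_le_sum (f := fun i => ‖F i‖) (fun _ _ => norm_nonneg _)
      (Finset.mem_univ i)).trans hN)
  exact ⟨a, Set.mem_iUnion.2 ⟨_, ha⟩, hlt⟩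

end

section
variable {G : Type*} [Group G]
    {V : Type*} [NormedAddCommGroup V] [NormedSpace ℝ V] 

theorem wap_bdd [CompleteSpace V] (ρ : G →* (V ≃L[ℝ] V))
    (hwap : ∀ v : V, IsCompact (closure ((toWeakSpace ℝ V) '' (Set.range fun g => ρ g v)))) :
    ∃ C : ℝ, 0 < C ∧ ∀ g v, ‖ρ g v‖ ≤ C * ‖v‖ := by
  obtain ⟨C, hC⟩ := banach_steinhaus (g := fun g : G => (ρ g : V →L[ℝ] V)) (by
    intro v
    obtain ⟨C, hC⟩ := banach_steinhaus
      (g := fun g : G => NormedSpace.inclusionInDoubleDualLi ℝ (ρ g v)) (by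
        intro f
        obtain ⟨C, hC⟩ := ((hwap v).image (wap_eval_cont f)).isBounded.exists_norm_le
        refine ⟨C, fun g => hC _ ⟨toWeakSpace ℝ V (ρ g v), subset_closure ⟨_, ⟨g, rfl⟩, rfl⟩, ?_⟩⟩
        simp [NormedSpace.inclusionInDoubleDualLi])
    exact ⟨C, fun g => by
      have := hC g
      rwa [LinearIsometry.norm_map] at this⟩)
  refine ⟨max C 1, by positivity, fun g v => ?_⟩
  calc ‖ρ g v‖ ≤ ‖(ρ g : V →L[ℝ] V)‖ * ‖v‖ := (ρ g : V →L[ℝ] V).le_opNorm v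
    _ ≤ max C 1 * ‖v‖ := by gcongr; exact (hC g).trans (le_max_left _ _)

theorem wap_one_apply (ρ : G →* (V ≃L[ℝ] V)) (v : V) : ρ 1 v = v := by
  rw [map_one]; rfl

theorem wap_inv_apply (ρ : G →* (V ≃L[ℝ] V)) (g : G) (v : V) : ρ g⁻¹ (ρ g v) = v := by
  have : (ρ g⁻¹ * ρ g) v = v := by
    rw [← map_mul]; simp only [inv_mul_cancel, mul_inv_cancel, wap_one_apply]
  exact this

theorem wap_apply_inv (ρ : G →* (V ≃L[ℝ] V)) (g : G) (v : V) : ρ g (ρ g⁻¹ v) = v := by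
  have : (ρ g * ρ g⁻¹) v = v := by
    rw [← map_mul]; simp only [inv_mul_cancel, mul_inv_cancel, wap_one_apply]
  exact this

theorem wap_mul_apply (ρ : G →* (V ≃L[ℝ] V)) (g h : G) (v : V) :
    ρ (g * h) v = ρ g (ρ h v) := by
  rw [map_mul]; rfl

theorem wap_act_cont (ρ : G →* (V ≃L[ℝ] V)) (g : G) :
    Continuous (fun x : WeakSpace ℝ V => toWeakSpace ℝ V (ρ g ((toWeakSpace ℝ V).symm x))) :=
  (WeakSpace.map (ρ g : V →L[ℝ] V)).continuous

theorem wap_local (ρ : G →* (V ≃L[ℝ] V)) (C : ℝ) (hC0 : 0 < C)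
    (hC : ∀ g v, ‖ρ g v‖ ≤ C * ‖v‖) (x : V)
    (hx : IsCompact (closure ((toWeakSpace ℝ V) '' (Set.range fun g => ρ g x))))
    (ε : ℝ) (hε : 0 < ε) :
    ∃ U : Set (WeakSpace ℝ V), IsOpen U ∧ toWeakSpace ℝ V x ∈ U ∧
      ∀ g, toWeakSpace ℝ V (ρ g x) ∈ U → ‖ρ g x - x‖ ≤ ε := by
  by_contra hcon
  push Not at hcon
  have h1 : toWeakSpace ℝ V x ∈ closure (toWeakSpace ℝ V '' {y | ∃ g, ρ g x = y ∧ ε < ‖y - x‖}) := by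
    rw [mem_closure_iff]
    intro U hU hxU
    obtain ⟨g, hg, hlt⟩ := hcon U hU hxU
    exact ⟨_, hg, _, ⟨g, rfl, hlt⟩, rfl⟩
  obtain ⟨D, hDA, hDc, hD⟩ := wap_kaplansky h1
  choose sel hsel hgt using hDA
  have : Countable D := hDc.to_subtype
  let H : Subgroup G := (FreeGroup.lift fun d : D => sel d.2).range
  have : Countable H := by
    have hF : Countable (FreeGroup D) :=
      (Quot.mk_surjective : Function.Surjective (Quot.mk (@FreeGroup.Red.Step D))).countable
    have : (Set.range (FreeGroup.lift fun d : D => sel d.2)).Countable := Set.countable_range _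
    exact this.to_subtype
  let O : Set V := Set.range fun h : H => ρ h x
  let Y : Set (WeakSpace ℝ V) := closure (toWeakSpace ℝ V '' O)
  have hYc : IsCompact Y := by
    refine hx.of_isClosed_subset isClosed_closure (closure_mono (Set.image_mono ?_))
    rintro _ ⟨h, rfl⟩
    exact ⟨h, rfl⟩
  have : CompactSpace Y := isCompact_iff_compactSpace.1 hYc
  have hxO : x ∈ O := ⟨1, wap_one_apply ρ _⟩
  have : Nonempty Y := ⟨⟨_, subset_closure ⟨x, hxO, rfl⟩⟩⟩
  have hsep : TopologicalSpace.IsSeparable (closure (Submodule.span ℝ O : Set V)) :=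
    ((Set.countable_range _).isSeparable.span).closure
  obtain ⟨c, hcc, hc⟩ := hsep
  have : Countable c := hcc.to_subtype
  have hYs : Y ⊆ toWeakSpace ℝ V '' closure c := by
    have h2 : Y ⊆ toWeakSpace ℝ V '' closure (Submodule.span ℝ O : Set V) := by
      rw [((Submodule.span ℝ O).convex).toWeakSpace_closure ℝ]
      exact closure_mono (Set.image_mono Submodule.subset_span)
    exact h2.trans (Set.image_mono hc)
  set δ := ε / (2 * C) with hδ
  have hδ0 : 0 < δ := by positivity
  obtain ⟨a, y0, hy0⟩ := nonempty_interior_of_iUnion_of_closed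
    (f := fun a : c => {y : Y | (y : WeakSpace ℝ V) ∈
      toWeakSpace ℝ V '' Metric.closedBall (a : V) δ})
    (fun a => (wap_closedBall _ _).preimage continuous_subtype_val) (by
      rw [Set.eq_univ_iff_forall]
      intro y
      obtain ⟨z, hz, hzy⟩ := hYs y.2
      obtain ⟨b, hb, hzb⟩ := Metric.mem_closure_iff.1 hz δ hδ0
      exact Set.mem_iUnion.2 ⟨⟨b, hb⟩, z, hzb.le, hzy⟩)
  obtain ⟨S, hSsub, hSo, hyS⟩ := mem_interior.1 hy0
  obtain ⟨W, hWo, rfl⟩ := isOpen_induced_iff.1 hSo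
  obtain ⟨_, hzW, _, ⟨h, rfl⟩, rfl⟩ := mem_closure_iff.1 y0.2 W hWo hyS
  have hball : ∀ k : H, toWeakSpace ℝ V (ρ k x) ∈ W → ρ k x ∈ Metric.closedBall (a : V) δ := by
    intro k hk
    have := hSsub (show (⟨_, subset_closure ⟨_, ⟨k, rfl⟩, rfl⟩⟩ : Y) ∈ _ from hk)
    obtain ⟨z, hz, hzz⟩ := this
    have := (toWeakSpace ℝ V).injective hzz
    change z = ρ k x at this
    rwa [← this]
  obtain ⟨_, hdW, d, hd, rfl⟩ := mem_closure_iff.1 hD _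
    (hWo.preimage (wap_act_cont ρ h)) (by simpa using hzW)
  have hdH : sel hd ∈ H := ⟨FreeGroup.of ⟨d, hd⟩, by simp⟩
  have b1 := hball h hzW
  have hmul : ρ ((h * ⟨sel hd, hdH⟩ : H) : G) x = ρ h d := by
    simp only [Subgroup.coe_mul]
    rw [wap_mul_apply, hsel hd]
  have b2 := hball (h * ⟨sel hd, hdH⟩) (by rw [hmul]; simpa using hdW)
  rw [hmul] at b2
  have b3 : ‖ρ h d - ρ h x‖ ≤ 2 * δ := by
    rw [← dist_eq_norm]
    have := dist_triangle_right (ρ h d) (ρ h x) (a : V)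
    simp only [Metric.mem_closedBall] at b1 b2
    linarith
  have b4 : ‖d - x‖ ≤ C * (2 * δ) := by
    have := hC (h : G)⁻¹ (ρ h d - ρ h x)
    rw [map_sub, wap_inv_apply, wap_inv_apply] at this
    exact this.trans (by gcongr)
  have : C * (2 * δ) = ε := by rw [hδ]; field_simp
  linarith [hgt hd]

theorem wap_kakutani (ρ : G →* (V ≃L[ℝ] V)) (C : ℝ) (hC0 : 0 < C)
    (hC : ∀ g v, ‖ρ g v‖ ≤ C * ‖v‖) (Q : Set V) (hQ : IsCompact Q) (hQn : Q.Nonempty)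
    (hQc : Convex ℝ Q) (hQi : ∀ g, ∀ x ∈ Q, ρ g x ∈ Q) :
    ∃ p ∈ Q, ∀ g, ρ g p = p := by
  classical
  obtain ⟨P, hPQ, hPn, hPcl, ⟨hPc, hPi⟩, hmin⟩ := wap_exists_minimal
    (fun s : Set V => Convex ℝ s ∧ ∀ g, ∀ x ∈ s, ρ g x ∈ s) (by
      intro c hc
      exact ⟨convex_sInter fun s hs => (hc s hs).1,
        fun g x hx s hs => (hc s hs).2 g x (hx s hs)⟩) Q hQ hQ.isClosed hQn ⟨hQc, hQi⟩
  have hPcomp : IsCompact P := hQ.of_isClosed_subset hPcl hPQ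
  have hPb := hPcomp.isBounded
  set d := Metric.diam P with hd
  have hd0 : d ≤ 0 := by
    by_contra! hdpos
    obtain ⟨t0, ht0P, ht0f, hcov⟩ := hPcomp.finite_cover_balls
      (show 0 < d / (2 * C) by positivity)
    lift t0 to Finset V using ht0f
    have hcov' : ∀ z ∈ P, ∃ y ∈ t0, dist z y < d / (2 * C) := by
      intro z hz
      have := hcov hz
      simpa using this
    have htn : t0.Nonempty := by
      obtain ⟨z, hz⟩ := hPn
      obtain ⟨y, hy, _⟩ := hcov' z hz
      exact ⟨y, hy⟩
    set n : ℝ := (t0.card : ℝ) with hn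
    have hn0 : 0 < n := by rw [hn]; exact_mod_cast htn.card_pos
    have hsumw : ∑ _y ∈ t0, n⁻¹ = 1 := by
      rw [Finset.sum_const, nsmul_eq_mul, ← hn]; field_simp
    let r : ℝ := d - n⁻¹ * (d / 2)
    have hr : r < d := by
      have : 0 < n⁻¹ * (d / 2) := by positivity
      simp only [r]; linarith
    let P' : Set V := {w | w ∈ P ∧ ∀ z ∈ P, ∀ g, ‖ρ g (w - z)‖ ≤ r}
    have hP' : P' = P := by
      apply hmin P' (fun w hw => hw.1)
      · refine ⟨∑ y ∈ t0, n⁻¹ • y, ?_, ?_⟩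
        · exact hPc.sum_mem (fun _ _ => by positivity) hsumw (fun y hy => ht0P hy)
        · intro z hz g
          obtain ⟨y0, hy0, hlt⟩ := hcov' z hz
          have e1 : ρ g ((∑ y ∈ t0, n⁻¹ • y) - z) = ∑ y ∈ t0, n⁻¹ • (ρ g y - ρ g z) := by
            simp only [smul_sub, Finset.sum_sub_distrib, ← Finset.sum_smul, hsumw, one_smul,
              map_sub, map_sum, map_smul]
          have e2 : ∀ y ∈ t0, ‖n⁻¹ • (ρ g y - ρ g z)‖ ≤
              n⁻¹ * d - (if y = y0 then n⁻¹ * (d / 2) else 0) := by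
            intro y hy
            rw [norm_smul, Real.norm_of_nonneg (inv_nonneg.2 hn0.le)]
            split_ifs with h
            · subst h
              have : ‖ρ g y - ρ g z‖ ≤ d / 2 := by
                rw [← map_sub]
                refine (hC _ _).trans ?_
                rw [dist_comm, dist_eq_norm] at hlt
                calc C * ‖y - z‖ ≤ C * (d / (2 * C)) := by gcongr
                  _ = d / 2 := by field_simp
              have := mul_le_mul_of_nonneg_left this (inv_nonneg.2 hn0.le)
              linarith
            · rw [sub_zero]
              gcongr
              rw [← dist_eq_norm]
              exact Metric.dist_le_diam_of_mem hPb (hPi g _ (ht0P hy)) (hPi g _ hz)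
          rw [e1]
          refine (norm_sum_le _ _).trans ((Finset.sum_le_sum e2).trans ?_)
          rw [Finset.sum_sub_distrib, ← Finset.sum_mul, hsumw, Finset.sum_ite_eq' t0 y0]
          simp [hy0, r]
      · have : P' = P ∩ ⋂ z ∈ P, ⋂ g, {w | ‖ρ g (w - z)‖ ≤ r} := by
          ext w; simp [P']
        rw [this]
        refine hPcl.inter (isClosed_biInter fun z _ => isClosed_iInter fun g => ?_)
        exact isClosed_le (by fun_prop) continuous_const
      · constructor
        · intro w hw w' hw' a b ha hb hab
          refine ⟨hPc hw.1 hw'.1 ha hb hab, fun z hz g => ?_⟩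
          have : ρ g (a • w + b • w' - z) = a • ρ g (w - z) + b • ρ g (w' - z) := by
            rw [← map_smul, ← map_smul, ← map_add]
            congr 1
            have : z = a • z + b • z := by rw [← add_smul, hab, one_smul]
            nth_rw 1 [this]
            simp only [smul_sub]; abel
          rw [this]
          refine (norm_add_le _ _).trans ?_
          rw [norm_smul, norm_smul, Real.norm_of_nonneg ha, Real.norm_of_nonneg hb]
          calc a * ‖ρ g (w - z)‖ + b * ‖ρ g (w' - z)‖ ≤ a * r + b * r := by
                gcongr
                · exact hw.2 z hz g
                · exact hw'.2 z hz g
            _ = r := by rw [← add_mul, hab, one_mul]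
        · intro h w hw
          refine ⟨hPi h w hw.1, fun z hz g => ?_⟩
          have := hw.2 (ρ h⁻¹ z) (hPi _ z hz) (g * h)
          rwa [wap_mul_apply, map_sub (ρ h), wap_apply_inv] at this
    have hr0 : 0 ≤ r := by
      obtain ⟨z, hz⟩ := hPn
      have hz' := hz
      rw [← hP'] at hz'
      exact (norm_nonneg _).trans (hz'.2 z hz 1)
    have : d ≤ r := by
      refine Metric.diam_le_of_forall_dist_le hr0 ?_
      intro w hw z hz
      rw [← hP'] at hw
      simpa only [dist_eq_norm, wap_one_apply] using hw.2 z hz 1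
    linarith
  obtain ⟨p, hp⟩ := hPn
  refine ⟨p, hPQ hp, fun g => ?_⟩
  have := Metric.dist_le_diam_of_mem hPb (hPi g p hp) hp
  exact dist_le_zero.1 (this.trans hd0)

theorem wap_fixed [CompleteSpace V] (ρ : G →* (V ≃L[ℝ] V)) (C : ℝ) (hC0 : 0 < C)
    (hC : ∀ g v, ‖ρ g v‖ ≤ C * ‖v‖)
    (hwap : ∀ v : V, IsCompact (closure ((toWeakSpace ℝ V) '' (Set.range fun g => ρ g v))))
    (v : V) : ∃ p ∈ closure (convexHull ℝ (Set.range fun g => ρ g v)), ∀ g, ρ g p = p := by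
  set e := toWeakSpace ℝ V with he
  have horb : ∀ y : V, ∀ g, ∀ z ∈ closure (e '' (Set.range fun g => ρ g y)),
      e (ρ g (e.symm z)) ∈ closure (e '' (Set.range fun g => ρ g y)) := by
    intro y g z hz
    refine map_mem_closure (f := fun z => e (ρ g (e.symm z))) (wap_act_cont ρ g) hz ?_
    rintro _ ⟨_, ⟨h, rfl⟩, rfl⟩
    refine ⟨ρ (g * h) y, ⟨_, rfl⟩, ?_⟩
    simp only [wap_mul_apply, LinearEquiv.symm_apply_apply]
  have hself : ∀ y : V, e y ∈ closure (e '' (Set.range fun g => ρ g y)) :=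
    fun y => subset_closure ⟨y, ⟨1, wap_one_apply ρ _⟩, rfl⟩
  obtain ⟨M, hMX, hMn, hMcl, hMi, hmin⟩ := wap_exists_minimal
    (fun s : Set (WeakSpace ℝ V) => ∀ g, ∀ z ∈ s, e (ρ g (e.symm z)) ∈ s)
    (fun c hc g x hx s hs => hc s hs g x (hx s hs)) _ (hwap v) isClosed_closure
    ⟨_, hself v⟩ (horb v)
  have hMc : IsCompact M := (hwap v).of_isClosed_subset hMcl hMX
  have hMorb : ∀ y, e y ∈ M → closure (e '' (Set.range fun g => ρ g y)) = M := by
    intro y hy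
    refine hmin _ ?_ ⟨_, hself y⟩ isClosed_closure (horb y)
    refine closure_minimal ?_ hMcl
    rintro _ ⟨_, ⟨g, rfl⟩, rfl⟩
    simpa using hMi g _ hy
  obtain ⟨x', hx'⟩ := hMn
  obtain ⟨x, rfl⟩ := e.surjective x'
  have htb : TotallyBounded (e.symm '' M) := by
    rw [Metric.totallyBounded_iff]
    intro ε hε
    set η := ε / (2 * C) with hη
    have hη0 : 0 < η := by positivity
    obtain ⟨U, hUo, hxU, hU⟩ := wap_local ρ C hC0 hC x (hwap x) η hη0
    have hUb : ∀ y, e y ∈ M → e y ∈ U → ‖y - x‖ ≤ η := by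
      intro y hyM hyU
      have hcl : e y ∈ closure (e '' Metric.closedBall x η) := by
        rw [mem_closure_iff]
        intro W hW hyW
        rw [← hMorb x hx'] at hyM
        obtain ⟨_, ⟨hzW, hzU⟩, _, ⟨g, rfl⟩, rfl⟩ :=
          mem_closure_iff.1 hyM (W ∩ U) (hW.inter hUo) ⟨hyW, hyU⟩
        refine ⟨_, hzW, _, ?_, rfl⟩
        rw [Metric.mem_closedBall, dist_eq_norm]
        exact hU g hzU
      rw [(wap_closedBall x η).closure_eq] at hcl
      obtain ⟨z, hz, hzy⟩ := hcl
      rw [← e.injective hzy, ← dist_eq_norm]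
      exact hz
    obtain ⟨t, ht⟩ := hMc.elim_finite_subcover
      (fun g : G => {z | e (ρ g (e.symm z)) ∈ U})
      (fun g => hUo.preimage (wap_act_cont ρ g)) (by
        intro z hz
        obtain ⟨y, rfl⟩ := e.surjective z
        have := hx'
        rw [← hMorb y hz] at this
        obtain ⟨_, hzU, _, ⟨g, rfl⟩, rfl⟩ := mem_closure_iff.1 this U hUo hxU
        exact Set.mem_iUnion.2 ⟨g, by simpa using hzU⟩)
    refine ⟨(fun g => ρ g⁻¹ x) '' t, t.finite_toSet.image _, ?_⟩
    rintro _ ⟨z, hz, rfl⟩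
    have h1 := ht hz
    simp only [Set.mem_iUnion] at h1
    obtain ⟨g, hg, hgU⟩ := h1
    refine Set.mem_iUnion₂.2 ⟨_, ⟨g, hg, rfl⟩, ?_⟩
    have h2 := hUb _ (hMi g z hz) hgU
    have h3 := hC g⁻¹ (ρ g (e.symm z) - x)
    rw [map_sub, wap_inv_apply] at h3
    rw [Metric.mem_ball, dist_eq_norm]
    calc _ ≤ C * ‖ρ g (e.symm z) - x‖ := h3
      _ ≤ C * η := by gcongr
      _ = ε / 2 := by rw [hη]; field_simp
      _ < ε := by linarith
  have hQ : IsCompact (closure (convexHull ℝ (e.symm '' M))) :=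
    htb.convexHull.closure.isCompact_of_isClosed isClosed_closure
  obtain ⟨p, hp, hfix⟩ := wap_kakutani ρ C hC0 hC _ hQ
    ⟨x, subset_closure (subset_convexHull ℝ _ ⟨_, hx', by simp⟩)⟩
    (convex_convexHull ℝ _).closure (by
      intro g y hy
      refine map_mem_closure (ρ g).continuous hy ?_
      intro z hz
      have : (ρ g : V →ₗ[ℝ] V) z ∈ (ρ g : V →ₗ[ℝ] V) '' convexHull ℝ (e.symm '' M) := ⟨z, hz, rfl⟩
      rw [LinearMap.image_convexHull] at this
      refine convexHull_mono ?_ this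
      rintro _ ⟨_, ⟨m, hm, rfl⟩, rfl⟩
      exact ⟨_, hMi g m hm, by simp⟩)
  refine ⟨p, ?_, hfix⟩
  refine closure_minimal (convexHull_min ?_ (convex_convexHull ℝ _).closure) isClosed_closure hp
  rintro _ ⟨m, hm, rfl⟩
  have h1 : m ∈ closure (e '' convexHull ℝ (Set.range fun g => ρ g v)) :=
    closure_mono (Set.image_mono (subset_convexHull ℝ _)) (hMX hm)
  rw [he, ← (convex_convexHull ℝ _).toWeakSpace_closure ℝ] at h1
  obtain ⟨z, hz, rfl⟩ := h1
  simpa [he] using hz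

end

section
variable {G : Type*} [Group G]
    {V : Type*} [NormedAddCommGroup V] [NormedSpace ℝ V]

/-- operators given by convex combinations of group elements -/
def wapAvg (ρ : G →* (V ≃L[ℝ] V)) : Set (V →L[ℝ] V) :=
  convexHull ℝ (Set.range fun g => (ρ g : V →L[ℝ] V))

theorem wapAvg_comp (ρ : G →* (V ≃L[ℝ] V)) {S T : V →L[ℝ] V} (hS : S ∈ wapAvg ρ)
    (hT : T ∈ wapAvg ρ) : S ∘L T ∈ wapAvg ρ := by
  have h1 : ∀ g, (ρ g : V →L[ℝ] V) ∘L T ∈ wapAvg ρ := by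
    intro g
    refine convexHull_min (t := {T | (ρ g : V →L[ℝ] V) ∘L T ∈ wapAvg ρ}) ?_ ?_ hT
    · rintro _ ⟨h, rfl⟩
      refine subset_convexHull ℝ _ ⟨g * h, ?_⟩
      ext v
      simp [wap_mul_apply]
    · intro A hA B hB a b ha hb hab
      have := (show Convex ℝ (wapAvg ρ) from convex_convexHull ℝ _) hA hB ha hb hab
      simpa [ContinuousLinearMap.comp_add, ContinuousLinearMap.comp_smul] using this
  refine convexHull_min (t := {S | S ∘L T ∈ wapAvg ρ}) ?_ ?_ hS
  · rintro _ ⟨g, rfl⟩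
    exact h1 g
  · intro A hA B hB a b ha hb hab
    have := (show Convex ℝ (wapAvg ρ) from convex_convexHull ℝ _) hA hB ha hb hab
    simpa [ContinuousLinearMap.add_comp, ContinuousLinearMap.smul_comp] using this

theorem wapAvg_fix (ρ : G →* (V ≃L[ℝ] V)) {S : V →L[ℝ] V} (hS : S ∈ wapAvg ρ)
    {w : V} (hw : ∀ g, ρ g w = w) : S w = w := by
  refine convexHull_min (t := {S : V →L[ℝ] V | S w = w}) ?_ ?_ hS
  · rintro _ ⟨g, rfl⟩
    exact hw g
  · intro A hA B hB a b ha hb hab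
    simp only [Set.mem_setOf_eq] at hA hB ⊢
    simp [hA, hB, ← add_smul, hab]

theorem wapAvg_bdd (ρ : G →* (V ≃L[ℝ] V)) {C : ℝ} (hC : ∀ g v, ‖ρ g v‖ ≤ C * ‖v‖)
    {S : V →L[ℝ] V} (hS : S ∈ wapAvg ρ) (v : V) : ‖S v‖ ≤ C * ‖v‖ := by
  refine convexHull_min (t := {S : V →L[ℝ] V | ‖S v‖ ≤ C * ‖v‖}) ?_ ?_ hS
  · rintro _ ⟨g, rfl⟩
    exact hC g v
  · intro A hA B hB a b ha hb hab
    simp only [Set.mem_setOf_eq] at hA hB ⊢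
    simp only [ContinuousLinearMap.add_apply, ContinuousLinearMap.smul_apply]
    refine (norm_add_le _ _).trans ?_
    rw [norm_smul, norm_smul, Real.norm_of_nonneg ha, Real.norm_of_nonneg hb]
    calc a * ‖A v‖ + b * ‖B v‖ ≤ a * (C * ‖v‖) + b * (C * ‖v‖) := by gcongr
      _ = C * ‖v‖ := by rw [← add_mul, hab, one_mul]

theorem wapAvg_one [CompleteSpace V] (ρ : G →* (V ≃L[ℝ] V)) (C : ℝ) (hC0 : 0 < C)
    (hC : ∀ g v, ‖ρ g v‖ ≤ C * ‖v‖)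
    (hwap : ∀ v : V, IsCompact (closure ((toWeakSpace ℝ V) '' (Set.range fun g => ρ g v))))
    (v : V) (ε : ℝ) (hε : 0 < ε) :
    ∃ S ∈ wapAvg ρ, ∃ w, (∀ g, ρ g w = w) ∧ ‖S v - w‖ < ε := by
  obtain ⟨p, hp, hfix⟩ := wap_fixed ρ C hC0 hC hwap v
  obtain ⟨q, hq, hlt⟩ := Metric.mem_closure_iff.1 hp ε hε
  have h1 : (Set.range fun g => ρ g v) =
      (ContinuousLinearMap.apply ℝ V v : (V →L[ℝ] V) →ₗ[ℝ] V) ''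
        (Set.range fun g => (ρ g : V →L[ℝ] V)) := by
    rw [← Set.range_comp]; rfl
  rw [h1, ← LinearMap.image_convexHull] at hq
  obtain ⟨S, hS, rfl⟩ := hq
  refine ⟨S, hS, p, hfix, ?_⟩
  rw [dist_comm, dist_eq_norm] at hlt
  exact hlt

theorem wapAvg_finite [CompleteSpace V] (ρ : G →* (V ≃L[ℝ] V)) (C : ℝ) (hC0 : 0 < C)
    (hC : ∀ g v, ‖ρ g v‖ ≤ C * ‖v‖)
    (hwap : ∀ v : V, IsCompact (closure ((toWeakSpace ℝ V) '' (Set.range fun g => ρ g v))))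
    (t : Set V) (ht : t.Finite) : ∀ (ε : ℝ), 0 < ε →
    ∃ S ∈ wapAvg ρ, ∀ v ∈ t, ∃ w, (∀ g, ρ g w = w) ∧ ‖S v - w‖ < ε := by
  induction t, ht using Set.Finite.induction_on with
  | empty =>
    intro ε _
    exact ⟨(ρ 1 : V →L[ℝ] V), subset_convexHull ℝ _ ⟨1, rfl⟩, by simp⟩
  | @insert a s _ _ ih =>
    intro ε hε
    obtain ⟨T, hT, hTs⟩ := ih (ε / C) (by positivity)
    obtain ⟨S, hS, w, hw, hlt⟩ := wapAvg_one ρ C hC0 hC hwap (T a) ε hε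
    refine ⟨S ∘L T, wapAvg_comp ρ hS hT, ?_⟩
    rintro v (rfl | hv)
    · exact ⟨w, hw, hlt⟩
    · obtain ⟨u, hu, hul⟩ := hTs v hv
      refine ⟨u, hu, ?_⟩
      have h1 : (S ∘L T) v - u = S (T v - u) := by
        rw [map_sub, wapAvg_fix ρ hS hu]; rfl
      rw [h1]
      calc _ ≤ C * ‖T v - u‖ := wapAvg_bdd ρ hC hS _
        _ < C * (ε / C) := by gcongr
        _ = ε := by field_simp

end

theorem convex_average_close_to_invariants
    {G : Type*} [Group G]
    {V : Type*} [NormedAddCommGroup V] [NormedSpace ℝ V] [CompleteSpace V]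
    (ρ : G →* (V ≃L[ℝ] V))
    -- `ρ` is weakly almost periodic:
    (hwap : ∀ v : V, IsCompact (closure ((toWeakSpace ℝ V) '' (Set.range fun g => ρ g v))))
    (K : Set V) (hK : IsCompact K)
    (ε : ℝ) (hε : 0 < ε) :
    ∃ (n : ℕ) (lam : Fin n → ℝ) (h : Fin n → G),
      (∀ i, 0 ≤ lam i) ∧ (∑ i, lam i) = 1 ∧
      ∀ v ∈ K, Metric.infDist (∑ i, lam i • ρ (h i) v) {w : V | ∀ g : G, ρ g w = w} < ε := by
  obtain ⟨C, hC0, hC⟩ := wap_bdd ρ hwap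
  obtain ⟨t, -, htf, hcov⟩ := hK.finite_cover_balls (show 0 < ε / (2 * C) by positivity)
  obtain ⟨S, hS, hSt⟩ := wapAvg_finite ρ C hC0 hC hwap t htf (ε / 2) (by positivity)
  have hmain : ∀ v ∈ K, Metric.infDist (S v) {w : V | ∀ g : G, ρ g w = w} < ε := by
    intro v hv
    have h1 := hcov hv
    simp only [Set.mem_iUnion] at h1
    obtain ⟨y, hy, hvy⟩ := h1
    obtain ⟨w, hw, hlt⟩ := hSt y hy
    refine (Metric.infDist_le_dist_of_mem (show w ∈ {w : V | ∀ g : G, ρ g w = w} from hw)).trans_lt ?_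
    rw [Metric.mem_ball, dist_eq_norm] at hvy
    have h2 : ‖S (v - y)‖ < ε / 2 := by
      calc _ ≤ C * ‖v - y‖ := wapAvg_bdd ρ hC hS _
        _ < C * (ε / (2 * C)) := by gcongr
        _ = ε / 2 := by field_simp
    rw [dist_eq_norm]
    have h3 : S v - w = S (v - y) + (S y - w) := by rw [map_sub]; abel
    rw [h3]
    linarith [norm_add_le (S (v - y)) (S y - w)]
  obtain ⟨ι, hι, lam, z, hl0, hl1, hz, hsum⟩ := mem_convexHull_iff_exists_fintype.1 hS
  choose h hh using hz
  let q := Fintype.equivFin ι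
  refine ⟨Fintype.card ι, lam ∘ q.symm, h ∘ q.symm, fun i => hl0 _, ?_, ?_⟩
  · rw [← hl1]
    exact Equiv.sum_comp q.symm lam
  · intro v hv
    have h1 : ∑ i, (lam ∘ q.symm) i • ρ ((h ∘ q.symm) i) v = S v := by
      rw [← hsum, ContinuousLinearMap.sum_apply]
      rw [← Equiv.sum_comp q.symm (fun i => (lam i • z i) v)]
      refine Finset.sum_congr rfl fun i _ => ?_
      simp [← hh]
    rw [h1]
    exact hmain v hv
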